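/- For every integer r ≥ 2 there exist constants β ≤ O(r²) and δ ≥ Ω(1/r²) such that for every finite edge-weighted graph G = (V,E) that excludes K_r as a minor and every Δ > 0, there is a probability distribution over partitions of V into clusters each of strong diameter at most Δ (diameter measured in the subgraph induced by the cluster) such that for every vertex z ∈ V and every 0 ≤ γ ≤ δ, the probability that the ball B_G(z, γΔ) is entirely contained in the cluster containing z is at least 2^{−βγ}. Moreover, the distribution can be sampled in polynomial time. -/

import Mathlib

open MeasureTheory Real ENNReal

namespace KPRpaper

variable {V : Type*}

/-- The total weight of a walk in an edge-weighted graph. -/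
def walkWeight (w : V → V → ℝ) {G : SimpleGraph V} {x y : V} (p : G.Walk x y) : ℝ :=
  (p.darts.map (fun d => w d.toProd.1 d.toProd.2)).sum

/-- Shortest-path distance between `x` and `y` using only walks whose vertices all
lie in the set `s` (`⊤` if there is no such walk). -/
noncomputable def dIn (G : SimpleGraph V) (w : V → V → ℝ) (s : Set V) (x y : V) : ℝ≥0∞ :=
  ⨅ p : {p : G.Walk x y // ∀ v ∈ p.support, v ∈ s}, ENNReal.ofReal (walkWeight w p.1)

/-- Shortest-path distance in the whole graph. -/
noncomputable def dG (G : SimpleGraph V) (w : V → V → ℝ) (x y : V) : ℝ≥0∞ :=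
  dIn G w Set.univ x y

/-- Distance from a point to a set, within the vertex set `s`. -/
noncomputable def dSet (G : SimpleGraph V) (w : V → V → ℝ) (s : Set V) (x : V) (A : Set V) :
    ℝ≥0∞ :=
  ⨅ a ∈ A, dIn G w s x a

/-- The ball of radius `ρ` around `z` in the shortest-path metric. -/
def gball (G : SimpleGraph V) (w : V → V → ℝ) (z : V) (ρ : ℝ) : Set V :=
  {v | dG G w z v ≤ ENNReal.ofReal ρ}

/-- The ball of radius `ρ` around the set `A`, inside the induced subgraph on `s`. -/
def gballIn (G : SimpleGraph V) (w : V → V → ℝ) (s A : Set V) (ρ : ℝ) : Set V :=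
  {v | v ∈ s ∧ dSet G w s v A ≤ ENNReal.ofReal ρ}

/-- `G` contains the complete graph `K_q` as a minor: there are `q` pairwise disjoint
nonempty vertex sets, each inducing a connected subgraph, with an edge between any two. -/
def HasCliqueMinor (G : SimpleGraph V) (q : ℕ) : Prop :=
  ∃ S : Fin q → Set V,
    (∀ i, (S i).Nonempty) ∧
    (∀ i, (G.induce (S i)).Connected) ∧
    (∀ i j, i ≠ j → Disjoint (S i) (S j)) ∧
    (∀ i j, i ≠ j → ∃ u ∈ S i, ∃ v ∈ S j, G.Adj u v)

/-- There is a walk from `x` to `y` all of whose vertices lie in `s`. -/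
def ReachableIn (G : SimpleGraph V) (s : Set V) (x y : V) : Prop :=
  ∃ p : G.Walk x y, ∀ v ∈ p.support, v ∈ s


/-- `Within G w C n x y`: there is a walk from `x` to `y` inside `C` of `w`-weight at most `n`. -/
inductive Within (G : SimpleGraph V) (w : V → V → ℕ) (C : Set V) : ℕ → V → V → Prop
  | refl (n : ℕ) (x : V) : x ∈ C → Within G w C n x x
  | step {k n : ℕ} {x y z : V} : x ∈ C → G.Adj x y → Within G w C n y z → w x y + n ≤ k →
      Within G w C k x z

namespace Within

variable {G : SimpleGraph V} {w : V → V → ℕ} {C D : Set V} {m n : ℕ} {x y z : V}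

lemma mem_left (h : Within G w C n x y) : x ∈ C := by
  cases h <;> assumption

lemma mem_right (h : Within G w C n x y) : y ∈ C := by
  induction h with
  | refl _ _ h => exact h
  | step _ _ _ _ ih => exact ih

lemma mono (h : Within G w C n x y) (hCD : C ⊆ D) (hnm : n ≤ m) : Within G w D m x y := by
  induction h generalizing m with
  | refl _ _ h => exact refl _ _ (hCD h)
  | step hx ha _ hk ih => exact step (hCD hx) ha (ih le_rfl) (hk.trans hnm)

lemma trans (h : Within G w C n x y) (h' : Within G w C m y z) : Within G w C (n + m) x z := by
  induction h with
  | refl _ _ _ => exact h'.mono subset_rfl (by omega)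
  | step hx ha _ hk ih => exact step hx ha (ih h') (by omega)

lemma symm (hw : ∀ u v, w u v = w v u) (h : Within G w C n x y) : Within G w C n y x := by
  induction h with
  | refl _ _ h => exact refl _ _ h
  | @step k n x y z hx ha h hk ih =>
    have : Within G w C (w x y) y x := step h.mem_left ha.symm (refl 0 x hx) (by rw [hw y x]; omega)
    exact (ih.trans this).mono subset_rfl (by omega)

/-- A walk survives in `D` if `D` contains the whole ball around its starting point. -/
lemma restrict (h : Within G w C n x y) (hD : ∀ v, Within G w C n x v → v ∈ D) :
    Within G w D n x y := by
  induction h with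
  | refl n x h => exact refl _ _ (hD x (refl _ _ h))
  | step hx ha h hk ih =>
    exact step (hD _ (refl _ _ hx)) ha (ih fun v hv => hD v (step hx ha hv hk)) hk

lemma restrict_right (h : Within G w C n x y) (hD : ∀ v, Within G w C n v y → v ∈ D) :
    Within G w D n x y := by
  induction h with
  | refl n x h => exact refl _ _ (hD x (refl _ _ h))
  | step hx ha h hk ih =>
    exact step (hD _ (step hx ha h hk)) ha
      (ih fun v hv => hD v (hv.mono subset_rfl (by omega))) hk

/-- The part of a walk before it first enters the ball of radius `R` around its end point. -/
lemma exists_exit {X : Set V} {R : ℕ} (h : Within G w C n x y) (hx : x ∉ X)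
    (hX : ∀ v, Within G w C R v y → v ∈ X) :
    ∃ s v u, s + R < n ∧ Within G w (C \ X) s x v ∧ G.Adj v u ∧ u ∈ X := by
  induction h with
  | refl n x h => exact absurd (hX x (refl _ _ h)) hx
  | @step k n x y z hxC ha h hk ih =>
    have hR : R < k := by
      by_contra hcon
      exact hx (hX _ (step hxC ha h (by omega)))
    by_cases hy : y ∈ X
    · exact ⟨0, x, y, by omega, refl _ _ ⟨hxC, hx⟩, ha, hy⟩
    · obtain ⟨s, v, u, hs, hv, hvu, hu⟩ := ih hy hX
      exact ⟨w x y + s, v, u, by omega, step ⟨hxC, hx⟩ ha hv le_rfl, hvu, hu⟩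

lemma reachable_induce (h : Within G w C n x y) (hx : x ∈ C) (hy : y ∈ C) :
    (G.induce C).Reachable ⟨x, hx⟩ ⟨y, hy⟩ := by
  induction h with
  | refl n x h => exact SimpleGraph.Reachable.refl _
  | @step k n x y z hxC ha h hk ih =>
    have : (G.induce C).Adj ⟨x, hx⟩ ⟨y, h.mem_left⟩ := by simpa using ha
    exact this.reachable.trans (ih h.mem_left hy)

end Within

lemma connected_induce_of_within {G : SimpleGraph V} {w : V → V → ℕ} {C : Set V} {x₀ : V}
    (hx₀ : x₀ ∈ C) (h : ∀ v ∈ C, ∃ n, Within G w C n v x₀) : (G.induce C).Connected := by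
  rw [SimpleGraph.connected_iff_exists_forall_reachable]
  refine ⟨⟨x₀, hx₀⟩, fun ⟨v, hv⟩ => ?_⟩
  obtain ⟨n, hn⟩ := h v hv
  exact (hn.reachable_induce hv hx₀).symm

/-- Distance from `x` to the root `x₀` inside `C`, with value `0` when `x₀` is not reachable. -/
noncomputable def depth (G : SimpleGraph V) (w : V → V → ℕ) (C : Set V) (x₀ x : V) : ℕ :=
  sInf {n | Within G w C n x x₀}

lemma within_depth {G : SimpleGraph V} {w : V → V → ℕ} {C : Set V} {x₀ x : V} {n : ℕ}
    (h : Within G w C n x x₀) : Within G w C (depth G w C x₀ x) x x₀ :=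
  Nat.sInf_mem (s := {n | Within G w C n x x₀}) ⟨n, h⟩

lemma depth_le {G : SimpleGraph V} {w : V → V → ℕ} {C : Set V} {x₀ x : V} {n : ℕ}
    (h : Within G w C n x x₀) : depth G w C x₀ x ≤ n :=
  Nat.sInf_le h

/-- Every vertex of the component of `x₀` lies on a geodesic ending in `x₀`. -/
lemma exists_geodesic {G : SimpleGraph V} {w : V → V → ℕ} (hw : ∀ u v, w u v = w v u)
    {C : Set V} {x₀ x : V} {n : ℕ} (h : Within G w C n x x₀) (hn : n = depth G w C x₀ x) :
    ∃ Q ⊆ C, x ∈ Q ∧ x₀ ∈ Q ∧ ∀ a ∈ Q, ∀ b ∈ Q,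
      depth G w C x₀ a ≤ depth G w C x₀ b → Within G w Q (depth G w C x₀ b - depth G w C x₀ a) b a
      := by
  suffices ∃ Q ⊆ C, x ∈ Q ∧ x₀ ∈ Q ∧ (∀ a ∈ Q, depth G w C x₀ a ≤ depth G w C x₀ x) ∧
      ∀ a ∈ Q, ∀ b ∈ Q, depth G w C x₀ a ≤ depth G w C x₀ b →
        Within G w Q (depth G w C x₀ b - depth G w C x₀ a) b a by
    obtain ⟨Q, h1, h2, h3, -, h4⟩ := this
    exact ⟨Q, h1, h2, h3, h4⟩
  induction h with
  | refl n x h =>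
    refine ⟨{x}, by simpa using h, rfl, rfl, by simp, ?_⟩
    rintro a rfl b rfl -
    exact Within.refl _ _ rfl
  | @step k n x y z hx ha h hk ih =>
    have h1 := within_depth h
    have h2 : depth G w C z x ≤ w x y + depth G w C z y := depth_le (.step hx ha h1 le_rfl)
    have h3 := depth_le h
    have hy : n = depth G w C z y := by omega
    have hxy : depth G w C z x = w x y + depth G w C z y := by omega
    obtain ⟨Q, hQC, hyQ, hzQ, hle, hQ⟩ := ih hy
    have hQ' : ∀ a ∈ Q, ∀ b ∈ Q, depth G w C z a ≤ depth G w C z b →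
        Within G w (insert x Q) (depth G w C z b - depth G w C z a) b a :=
      fun a ha b hb hab => (hQ a ha b hb hab).mono (Set.subset_insert _ _) le_rfl
    have hxa : ∀ a ∈ Q, Within G w (insert x Q) (depth G w C z x - depth G w C z a) x a := by
      intro a haQ
      have := hle a haQ
      exact .step (Set.mem_insert _ _) ha (hQ' a haQ y hyQ this) (by omega)
    refine ⟨insert x Q, Set.insert_subset hx hQC, Set.mem_insert _ _, Set.mem_insert_of_mem _ hzQ,
      ?_, ?_⟩
    · rintro a (rfl | haQ)
      · exact le_rfl
      · have := hle a haQ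
        omega
    · rintro a (rfl | haQ) b (rfl | hbQ) hab
      · exact .refl _ _ (Set.mem_insert _ _)
      · have := hle b hbQ
        exact ((hxa b hbQ).symm hw).mono subset_rfl (by omega)
      · exact hxa a haQ
      · exact hQ' a haQ b hbQ hab

/-- The component of `x` in `U` has a vertex adjacent to `X`. -/
def TouchesComp (G : SimpleGraph V) (w : V → V → ℕ) (U : Set V) (x : V) (X : Set V) : Prop :=
  ∃ n y, Within G w U n x y ∧ ∃ v ∈ X, G.Adj y v

/-- A family `𝒳` of supernodes removed so far, `U` being the set of remaining vertices: the
supernodes touching a common component of `U` are pairwise adjacent. -/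
structure IsCopState (G : SimpleGraph V) (w : V → V → ℕ) (U : Set V) (𝒳 : Set (Set V)) :
    Prop where
  connected : ∀ X ∈ 𝒳, (G.induce X).Connected
  disjoint_left : ∀ X ∈ 𝒳, Disjoint X U
  disjoint : ∀ X ∈ 𝒳, ∀ Y ∈ 𝒳, X ≠ Y → Disjoint X Y
  adj : ∀ x, ∀ X ∈ 𝒳, ∀ Y ∈ 𝒳, X ≠ Y → TouchesComp G w U x X → TouchesComp G w U x Y →
    ∃ u ∈ X, ∃ v ∈ Y, G.Adj u v

lemma HasCliqueMinor.mono {G : SimpleGraph V} {p q : ℕ} (h : HasCliqueMinor G q) (hpq : p ≤ q) :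
    HasCliqueMinor G p := by
  obtain ⟨S, h1, h2, h3, h4⟩ := h
  have hinj := Fin.castLE_injective hpq
  exact ⟨fun i => S (Fin.castLE hpq i), fun i => h1 _, fun i => h2 _,
    fun i j hij => h3 _ _ (hinj.ne hij), fun i j hij => h4 _ _ (hinj.ne hij)⟩

lemma IsCopState.card_add_one_lt {G : SimpleGraph V} {w : V → V → ℕ}
    (hw : ∀ u v, w u v = w v u) {U : Set V}
    {𝒳 : Set (Set V)} (h : IsCopState G w U 𝒳) {r : ℕ} (hr : ¬ HasCliqueMinor G r)
    {F : Finset (Set V)} (hF : ↑F ⊆ 𝒳) {x : V} (hx : x ∈ U)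
    (ht : ∀ X ∈ F, TouchesComp G w U x X) : F.card + 1 < r := by
  by_contra hcon
  refine hr (HasCliqueMinor.mono (q := F.card + 1) ?_ (by omega))
  set C : Set V := {v | ∃ n, Within G w U n v x} with hC
  have hxC : x ∈ C := ⟨0, .refl _ _ hx⟩
  have hCU : C ⊆ U := fun v ⟨n, hn⟩ => hn.mem_left
  have hCconn : (G.induce C).Connected := by
    refine connected_induce_of_within (w := w) hxC fun v ⟨n, hn⟩ => ⟨n, ?_⟩
    exact hn.restrict_right fun u hu => ⟨_, hu⟩
  set e : Fin F.card → Set V := fun i => (F.equivFin.symm i : Set V) with he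
  have heF : ∀ i, e i ∈ F := fun i => (F.equivFin.symm i).2
  have hinj : Function.Injective e := fun i j hij =>
    F.equivFin.symm.injective (Subtype.ext hij)
  have hadj : ∀ i, ∃ u ∈ C, ∃ v ∈ e i, G.Adj u v := by
    intro i
    obtain ⟨n, y, hy, v, hv, hyv⟩ := ht _ (heF i)
    exact ⟨y, ⟨n, hy.symm hw⟩, v, hv, hyv⟩
  refine ⟨Fin.cons C e, ?_, ?_, ?_, ?_⟩
  · intro i
    refine Fin.cases ?_ (fun i => ?_) i
    · exact ⟨x, hxC⟩
    · have := (h.connected _ (hF (heF i))).nonempty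
      simpa using Set.nonempty_coe_sort.1 this
  · intro i
    refine Fin.cases ?_ (fun i => ?_) i
    · exact hCconn
    · exact h.connected _ (hF (heF i))
  · intro i j
    refine Fin.cases ?_ (fun i => ?_) i <;> refine Fin.cases ?_ (fun j => ?_) j <;> intro hij
    · exact absurd rfl hij
    · exact ((h.disjoint_left _ (hF (heF j))).mono_right hCU).symm
    · exact ((h.disjoint_left _ (hF (heF i))).mono_right hCU)
    · exact h.disjoint _ (hF (heF i)) _ (hF (heF j)) (hinj.ne fun h => hij (by rw [h]))
  · intro i j
    refine Fin.cases ?_ (fun i => ?_) i <;> refine Fin.cases ?_ (fun j => ?_) j <;> intro hij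
    · exact absurd rfl hij
    · exact hadj j
    · obtain ⟨u, hu, v, hv, huv⟩ := hadj i
      exact ⟨v, hv, u, hu, huv.symm⟩
    · exact h.adj x _ (hF (heF i)) _ (hF (heF j)) (hinj.ne fun h => hij (by rw [h]))
        (ht _ (heF i)) (ht _ (heF j))

/-- `X` is covered by the `2N`-balls around centers of which each vertex of `X` has at most `q`
within distance `4N`, distances being measured inside `X`. -/
def HasSparseCenters (G : SimpleGraph V) (w : V → V → ℕ) (N q : ℕ) (X : Set V) : Prop :=
  ∃ K ⊆ X, (∀ v ∈ X, ∃ c ∈ K, Within G w X (2 * N) v c) ∧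
    ∀ z, {c ∈ K | Within G w X (4 * N) z c}.ncard ≤ q

/-- The ball of radius `R` around `T` inside `U`. -/
def ballAround (G : SimpleGraph V) (w : V → V → ℕ) (U T : Set V) (R : ℕ) : Set V :=
  {v | ∃ t ∈ T, Within G w U R v t}

lemma ballAround_subset {G : SimpleGraph V} {w : V → V → ℕ} {U T : Set V} {R : ℕ} :
    ballAround G w U T R ⊆ U := fun _ ⟨_, _, h⟩ => h.mem_left

lemma Within.within_ballAround {G : SimpleGraph V} {w : V → V → ℕ} {U T : Set V} {R n : ℕ}
    {v t : V} (h : Within G w U n v t) (hn : n ≤ R) (ht : t ∈ T) :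
    Within G w (ballAround G w U T R) n v t :=
  h.restrict_right fun _ hu => ⟨t, ht, hu.mono subset_rfl hn⟩

open Classical in
/-- The supernode step of the cop decomposition: a union `T` of few geodesics with a common root,
meeting a neighbour of every touching supernode. -/
lemma IsCopState.exists_skeleton [Finite V] {G : SimpleGraph V} {w : V → V → ℕ}
    (hw : ∀ u v, w u v = w v u) {U : Set V}
    {𝒳 : Set (Set V)} (h : IsCopState G w U 𝒳) {r : ℕ} (hr : ¬ HasCliqueMinor G r)
    {x₀ : V} (hx₀ : x₀ ∈ U) {N : ℕ} (hN : 0 < N) :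
    ∃ T ⊆ U, x₀ ∈ T ∧ ∀ R ≤ N,
      IsCopState G w (U \ ballAround G w U T R) (insert (ballAround G w U T R) 𝒳) ∧
      HasSparseCenters G w N (9 * r) (ballAround G w U T R) := by
  set 𝒯 : Finset (Set V) := (Set.toFinite {A ∈ 𝒳 | TouchesComp G w U x₀ A}).toFinset with h𝒯
  have hmem : ∀ A, A ∈ 𝒯 ↔ A ∈ 𝒳 ∧ TouchesComp G w U x₀ A := fun A => by simp [h𝒯]
  have hcard : 𝒯.card + 1 < r := h.card_add_one_lt hw hr (fun A hA => ((hmem A).1 hA).1) hx₀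
    fun A hA => ((hmem A).1 hA).2
  have hy : ∀ A, ∃ y, A ∈ 𝒯 → (∃ n, Within G w U n x₀ y) ∧ ∃ v ∈ A, G.Adj y v := by
    intro A
    by_cases hA : A ∈ 𝒯
    · obtain ⟨n, y, hy, hv⟩ := ((hmem A).1 hA).2
      exact ⟨y, fun _ => ⟨⟨n, hy⟩, hv⟩⟩
    · exact ⟨x₀, fun h => absurd h hA⟩
  choose y hy using hy
  set Y : Finset V := insert x₀ (𝒯.image y) with hY
  have hYcard : Y.card ≤ r := by
    have h1 : Y.card ≤ (𝒯.image y).card + 1 := Finset.card_insert_le _ _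
    have h2 : (𝒯.image y).card ≤ 𝒯.card := Finset.card_image_le
    omega
  have hYU : ∀ a ∈ Y, ∃ n, Within G w U n a x₀ := by
    intro a ha
    rcases Finset.mem_insert.1 ha with rfl | ha
    · exact ⟨0, .refl _ _ hx₀⟩
    · obtain ⟨A, hA, rfl⟩ := Finset.mem_image.1 ha
      obtain ⟨n, hn⟩ := (hy A hA).1
      exact ⟨n, hn.symm hw⟩
  set D : V → ℕ := depth G w U x₀ with hD
  have hQ : ∀ a, ∃ Q, a ∈ Y → Q ⊆ U ∧ a ∈ Q ∧ x₀ ∈ Q ∧ ∀ b ∈ Q, ∀ c ∈ Q,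
      D b ≤ D c → Within G w Q (D c - D b) c b := by
    intro a
    by_cases ha : a ∈ Y
    · obtain ⟨n, hn⟩ := hYU a ha
      obtain ⟨Q, hQ⟩ := exists_geodesic hw (within_depth hn) rfl
      exact ⟨Q, fun _ => hQ⟩
    · exact ⟨∅, fun h => absurd h ha⟩
  choose Q hQ using hQ
  set T : Set V := {t | ∃ a ∈ Y, t ∈ Q a} with hT
  have hTU : T ⊆ U := fun t ⟨a, ha, ht⟩ => (hQ a ha).1 ht
  have hx₀Y : x₀ ∈ Y := Finset.mem_insert_self _ _
  have hx₀T : x₀ ∈ T := ⟨x₀, hx₀Y, (hQ _ hx₀Y).2.1⟩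
  have hDx₀ : D x₀ = 0 := Nat.le_zero.1 (depth_le (.refl 0 _ hx₀))
  have hTroot : ∀ t ∈ T, ∃ n, Within G w T n t x₀ := by
    rintro t ⟨a, ha, ht⟩
    obtain ⟨-, -, hx, hQa⟩ := hQ a ha
    exact ⟨_, (hQa _ hx _ ht (by rw [hDx₀]; exact Nat.zero_le _)).mono
      (fun b hb => ⟨a, ha, hb⟩) le_rfl⟩
  refine ⟨T, hTU, hx₀T, fun R hR => ?_⟩
  set X := ballAround G w U T R with hX
  have hXU : X ⊆ U := ballAround_subset
  have hTX : T ⊆ X := fun t ht => ⟨t, ht, .refl _ _ (hTU ht)⟩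
  have hx₀X : x₀ ∈ X := hTX hx₀T
  have hXroot : ∀ v ∈ X, ∃ n, Within G w X n v x₀ := by
    rintro v ⟨t, ht, hvt⟩
    obtain ⟨n, hn⟩ := hTroot t ht
    exact ⟨_, (hvt.within_ballAround le_rfl ht).trans (hn.mono hTX le_rfl)⟩
  constructor
  · have hcomp : ∀ x A, TouchesComp G w (U \ X) x A → TouchesComp G w U x A :=
      fun x A ⟨n, y, hy, hv⟩ => ⟨n, y, hy.mono Set.sdiff_subset le_rfl, hv⟩
    have hkey : ∀ x, ∀ A ∈ 𝒳, TouchesComp G w (U \ X) x A → TouchesComp G w (U \ X) x X →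
        ∃ u ∈ A, ∃ v ∈ X, G.Adj u v := by
      rintro x A hA htA ⟨n, b, hb, v, hv, hbv⟩
      obtain ⟨n', a, ha, hav⟩ := hcomp _ _ htA
      obtain ⟨k, hk⟩ := hXroot v hv
      have h1 : Within G w U _ x₀ x :=
        (((hb.mono Set.sdiff_subset le_rfl).trans
          (.step hb.mem_right.1 hbv (hk.mono hXU le_rfl) le_rfl)).symm hw)
      have hA𝒯 : A ∈ 𝒯 := (hmem A).2 ⟨hA, _, a, h1.trans ha, hav⟩
      obtain ⟨-, u, hu, hyu⟩ := hy A hA𝒯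
      have hyY : y A ∈ Y := Finset.mem_insert_of_mem (Finset.mem_image_of_mem _ hA𝒯)
      exact ⟨u, hu, y A, hTX ⟨_, hyY, (hQ _ hyY).2.1⟩, hyu.symm⟩
    refine ⟨?_, ?_, ?_, ?_⟩
    · rintro A (rfl | hA)
      · exact connected_induce_of_within hx₀X hXroot
      · exact h.connected A hA
    · rintro A (rfl | hA)
      · exact Set.disjoint_sdiff_right
      · exact (h.disjoint_left A hA).mono_right Set.sdiff_subset
    · rintro A (rfl | hA) B (rfl | hB) hAB
      · exact absurd rfl hAB
      · exact ((h.disjoint_left B hB).mono_right hXU).symm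
      · exact (h.disjoint_left A hA).mono_right hXU
      · exact h.disjoint A hA B hB hAB
    · rintro x A (rfl | hA) B (rfl | hB) hAB htA htB
      · exact absurd rfl hAB
      · obtain ⟨u, hu, v, hv, huv⟩ := hkey x B hB htB htA
        exact ⟨v, hv, u, hu, huv.symm⟩
      · exact hkey x A hA htA htB
      · exact h.adj x A hA B hB hAB (hcomp _ _ htA) (hcomp _ _ htB)
  · have hsel : ∀ a k, ∃ c, (∃ t ∈ Q a, D t / N = k) → c ∈ Q a ∧ D c / N = k := by
      intro a k
      by_cases hex : ∃ t ∈ Q a, D t / N = k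
      · obtain ⟨t, ht⟩ := hex
        exact ⟨t, fun _ => ht⟩
      · exact ⟨x₀, fun h => absurd h hex⟩
    choose sel hsel using hsel
    refine ⟨{c | ∃ a ∈ Y, ∃ t ∈ Q a, c = sel a (D t / N)}, ?_, ?_, ?_⟩
    · rintro c ⟨a, ha, t, ht, rfl⟩
      exact hTX ⟨a, ha, (hsel a _ ⟨t, ht, rfl⟩).1⟩
    · rintro v ⟨t, ⟨a, ha, ht⟩, hvt⟩
      obtain ⟨h1, h2⟩ := hsel a _ ⟨t, ht, rfl⟩
      refine ⟨_, ⟨a, ha, t, ht, rfl⟩, ?_⟩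
      set c := sel a (D t / N)
      have hQX : Q a ⊆ X := fun b hb => hTX ⟨a, ha, hb⟩
      have h3 := Nat.div_add_mod (D t) N
      have h4 := Nat.div_add_mod (D c) N
      have h5 := Nat.mod_lt (D t) hN
      have h6 := Nat.mod_lt (D c) hN
      rw [h2] at h4
      have htc : Within G w X N t c := by
        rcases le_total (D t) (D c) with hle | hle
        · exact (((hQ a ha).2.2.2 t ht c h1 hle).symm hw).mono hQX (by omega)
        · exact ((hQ a ha).2.2.2 c h1 t ht hle).mono hQX (by omega)
      have htT : t ∈ T := ⟨a, ha, ht⟩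
      exact ((hvt.within_ballAround le_rfl htT).trans htc).mono subset_rfl (by omega)
    · intro z
      have hsub : {c ∈ {c | ∃ a ∈ Y, ∃ t ∈ Q a, c = sel a (D t / N)} |
          Within G w X (4 * N) z c} ⊆
          ↑((Y ×ˢ Finset.Icc (D z / N - 4) (D z / N + 4)).image fun p => sel p.1 p.2) := by
        rintro c ⟨⟨a, ha, t, ht, rfl⟩, hzc⟩
        obtain ⟨h1, h2⟩ := hsel a _ ⟨t, ht, rfl⟩
        set c := sel a (D t / N) with hc
        have hzcU := hzc.mono hXU le_rfl
        obtain ⟨n, hn⟩ := hXroot c hzc.mem_right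
        have hcd := within_depth (hn.mono hXU le_rfl)
        have h3 : D z ≤ D c + 4 * N := by
          have := depth_le (hzcU.trans hcd)
          simp only [hD]; omega
        have h4 : D c ≤ D z + 4 * N := by
          have := depth_le ((hzcU.symm hw).trans (within_depth (hzcU.trans hcd)))
          simp only [hD]; omega
        have h5 : D z / N ≤ D c / N + 4 := by
          rw [← Nat.add_mul_div_right _ _ hN]; exact Nat.div_le_div_right h3
        have h6 : D c / N ≤ D z / N + 4 := by
          rw [← Nat.add_mul_div_right _ _ hN]; exact Nat.div_le_div_right h4
        simp only [Finset.coe_image, Set.mem_image, Finset.mem_coe, Finset.mem_product,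
          Finset.mem_Icc]
        rw [h2] at h5 h6
        exact ⟨(a, D t / N), ⟨ha, Nat.sub_le_iff_le_add.2 h5, h6⟩, rfl⟩
      calc _ ≤ _ := Set.ncard_le_ncard hsub (Finset.finite_toSet _)
        _ ≤ (Y ×ˢ Finset.Icc (D z / N - 4) (D z / N + 4)).card := by
          rw [Set.ncard_coe_finset]; exact Finset.card_image_le
        _ ≤ 9 * r := by
          rw [Finset.card_product, Nat.card_Icc, mul_comm]
          exact Nat.mul_le_mul (by omega) hYcard

lemma exists_half_root {m : ℕ} (hm : 0 < m) :
    ∃ σ : ℝ, 0 < σ ∧ σ ≤ 1 ∧ σ ^ m = 1 / 2 ∧ 1 - σ ≤ 1 / m := by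
  have hm' : (0 : ℝ) < m := by exact_mod_cast hm
  obtain ⟨σ, hσ0, hσ⟩ : ∃ σ : ℝ, 0 < σ ∧ σ ^ m = 1 / 2 :=
    ⟨(1 / 2 : ℝ) ^ ((m : ℝ)⁻¹), by positivity,
      Real.rpow_inv_natCast_pow (by norm_num) hm.ne'⟩
  have hσ1 : σ ≤ 1 := by
    by_contra hcon
    have := one_le_pow₀ (not_le.1 hcon).le (n := m)
    linarith
  refine ⟨σ, hσ0, hσ1, hσ, ?_⟩
  have h1 : 1 + (m : ℝ) * (σ⁻¹ - 1) ≤ (1 + (σ⁻¹ - 1)) ^ m :=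
    one_add_mul_le_pow (by have := inv_pos.2 hσ0; linarith) m
  rw [add_sub_cancel, inv_pow, hσ] at h1
  have h2 : 1 - σ ≤ σ⁻¹ - 1 := by
    have : σ * σ⁻¹ = 1 := mul_inv_cancel₀ hσ0.ne'
    nlinarith [sq_nonneg (σ - 1), inv_pos.2 hσ0]
  rw [le_div_iff₀ hm']
  nlinarith

/-- A tail function for the radius of a supernode: its decay rate is bounded by `5 / m`, it decays
slowly first and fast before it is cut off at `4 * r * m`. -/
structure IsRadiusTail (r m : ℕ) (E η : ℝ) (S : ℕ → ℝ) : Prop where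
  antitone : Antitone S
  zero : S 0 = 1
  cutoff : ∀ k, 4 * r * m ≤ k → S k = 0
  decay : ∀ x, S (x + m) ≤ S x / 2
  slow_start : 2 * 2 ^ r * η + E ≤ S (2 * r * m)
  fast_end : ∀ x, x + r * m ≤ 4 * r * m → E ≤ η * S x
  rate : ∀ x y : ℕ, S x - S (x + y) ≤ 5 * y / m * (S x + E)

lemma exists_isRadiusTail {r m : ℕ} (hr : 2 ≤ r) (hm : 0 < m) :
    ∃ E η S, 0 < η ∧ IsRadiusTail r m E η S := by
  obtain ⟨σ, hσ0, hσ1, hσ, hσm⟩ := exists_half_root hm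
  have hm' : (0 : ℝ) < m := by exact_mod_cast hm
  have hpow : ∀ k, σ ^ (k * m) = (1 / 2) ^ k := fun k => by rw [mul_comm, pow_mul, hσ]
  set e : ℝ := (1 / 2) ^ (20 * r) with he
  set A : ℝ := 2 * 2 ^ (10 * r) with hA
  have he0 : 0 < e := by positivity
  have hA0 : 0 < A := by positivity
  have hA2 : 2 ≤ A := by
    have : (1 : ℝ) ≤ 2 ^ (10 * r) := one_le_pow₀ (by norm_num)
    linarith
  have heq : σ ^ (5 * (4 * r * m)) = e := by
    rw [he, ← hpow]; congr 1; ring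
  have hemono : ∀ k, 4 * r * m ≤ k → σ ^ (5 * k) ≤ e := fun k hk => by
    rw [← heq]; exact pow_le_pow_of_le_one hσ0.le hσ1 (Nat.mul_le_mul_left 5 hk)
  have hAe : A * e = 2 * (1 / 2) ^ (10 * r) := by
    have : (2 : ℝ) ^ (10 * r) * (1 / 2) ^ (10 * r) = 1 := by rw [← mul_pow]; norm_num
    rw [hA, he, show 20 * r = 10 * r + 10 * r by ring, pow_add]
    linear_combination (2 * (1 / 2 : ℝ) ^ (10 * r)) * this
  set S₂ : ℕ → ℝ := fun k => A * (σ ^ (5 * k) - e) with hS₂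
  have hanti₂ : Antitone S₂ := fun a b hab => by
    have : σ ^ (5 * b) ≤ σ ^ (5 * a) := pow_le_pow_of_le_one hσ0.le hσ1 (by omega)
    simp only [hS₂]; gcongr
  have hrate : ∀ k y : ℕ, k ≤ 5 → 1 - σ ^ (k * y) ≤ 5 * y / m := by
    intro k y hk
    have h1 : 1 + ((k * y : ℕ) : ℝ) * (σ - 1) ≤ (1 + (σ - 1)) ^ (k * y) :=
      one_add_mul_le_pow (by linarith) _
    rw [add_sub_cancel] at h1
    have h2 : ((k * y : ℕ) : ℝ) ≤ 5 * y := by exact_mod_cast Nat.mul_le_mul_right y hk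
    have h3 : ((k * y : ℕ) : ℝ) * (1 - σ) ≤ 5 * y * (1 / m) := by gcongr
    have h4 : 5 * (y : ℝ) * (1 / m) = 5 * y / m := by ring
    linarith
  refine ⟨A * e, (1 / 8) ^ r / 4, fun k => max 0 (min (σ ^ k) (S₂ k)),
    by positivity, ?_, ?_, ?_, ?_, ?_, ?_, ?_⟩
  · intro a b hab
    exact max_le_max le_rfl (min_le_min (pow_le_pow_of_le_one hσ0.le hσ1 hab) (hanti₂ hab))
  · have : e ≤ 1 / 2 := by
      rw [he, show 20 * r = (20 * r - 1) + 1 by omega, pow_succ]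
      have : (1 / 2 : ℝ) ^ (20 * r - 1) ≤ 1 := pow_le_one₀ (by norm_num) (by norm_num)
      linarith
    have h1 : (1 : ℝ) ≤ S₂ 0 := by simp only [hS₂, mul_zero, pow_zero]; nlinarith
    simp [h1]
  · intro k hk
    have : S₂ k ≤ 0 := mul_nonpos_of_nonneg_of_nonpos hA0.le (by linarith [hemono k hk])
    exact max_eq_left ((min_le_right _ _).trans this)
  · intro x
    rw [← max_div_div_right (by norm_num), zero_div, ← min_div_div_right (by norm_num)]
    refine max_le_max le_rfl (min_le_min ?_ ?_)
    · rw [pow_add, hσ]; linarith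
    · simp only [hS₂]
      have h1 : σ ^ (5 * (x + m)) = σ ^ (5 * x) * (1 / 2) ^ 5 := by
        rw [← hpow, ← pow_add]; congr 1; ring
      rw [h1]
      have : 0 < A * σ ^ (5 * x) := by positivity
      nlinarith [mul_pos hA0 he0]
  · have h2 : (2 : ℝ) * 2 ^ r * ((1 / 8) ^ r / 4) = (1 / 4) ^ r / 2 := by
      rw [show (1 / 4 : ℝ) = 2 * (1 / 8) by norm_num, mul_pow]; ring
    have h4 : (1 / 2 : ℝ) ^ (10 * r) = (1 / 1024) ^ r := by rw [pow_mul]; norm_num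
    have h5 : (1 / 1024 : ℝ) ^ r ≤ (1 / 4) ^ r / 4 := by
      have : (1 / 256 : ℝ) ^ r ≤ (1 / 256) ^ 2 :=
        pow_le_pow_of_le_one (by norm_num) (by norm_num) hr
      rw [show (1 / 1024 : ℝ) = (1 / 4) * (1 / 256) by norm_num, mul_pow]
      have : (0 : ℝ) < (1 / 4) ^ r := by positivity
      nlinarith
    have h6 : (1 / 4 : ℝ) ^ r ≤ 1 := pow_le_one₀ (by norm_num) (by norm_num)
    rw [h2, hAe]
    refine le_trans ?_ (le_max_right _ _)
    refine le_min ?_ ?_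
    · have h7 : (1 / 2 : ℝ) ^ (2 * r) = (1 / 4) ^ r := by rw [pow_mul]; norm_num
      rw [hpow, h4, h7]; linarith
    · simp only [hS₂]
      rw [show 5 * (2 * r * m) = (10 * r) * m by ring, hpow, mul_sub, hAe]
      have : A * (1 / 2) ^ (10 * r) = 2 := by
        rw [hA, mul_assoc, ← mul_pow]; norm_num
      rw [this, h4]; linarith
  · intro x hx
    have h4 : (1 / 2 : ℝ) ^ (10 * r) = (1 / 1024) ^ r := by rw [pow_mul]; norm_num
    have h8 : (0 : ℝ) < (1 / 8) ^ r := by positivity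
    rw [← div_le_iff₀' (by positivity)]
    refine le_trans ?_ (le_max_right _ _)
    have hsmall : (1 / 8 : ℝ) ^ r ≤ (1 / 8) ^ 2 :=
        pow_le_pow_of_le_one (by norm_num) (by norm_num) hr
    refine le_min ?_ ?_
    · have h5 : (1 / 16 : ℝ) ^ r ≤ σ ^ x := by
        have : (1 / 16 : ℝ) ^ r = σ ^ (4 * r * m) := by rw [hpow, pow_mul]; norm_num
        rw [this]
        exact pow_le_pow_of_le_one hσ0.le hσ1 (by omega)
      refine le_trans ?_ h5
      rw [div_le_iff₀ (by positivity), hAe, h4]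
      have : (1 / 1024 : ℝ) ^ r = (1 / 16) ^ r * (1 / 8) ^ r * (1 / 8) ^ r := by
        rw [← mul_pow, ← mul_pow]; norm_num
      rw [this]
      have : (0 : ℝ) < (1 / 16) ^ r * (1 / 8) ^ r := by positivity
      nlinarith
    · have h5 : 32 ^ r * e ≤ σ ^ (5 * x) := by
        have h6 : σ ^ (5 * (3 * r * m)) = 32 ^ r * e := by
          rw [show 5 * (3 * r * m) = (15 * r) * m by ring, hpow, he, pow_mul, pow_mul, ← mul_pow]
          norm_num
        rw [← h6]
        refine pow_le_pow_of_le_one hσ0.le hσ1 ?_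
        have : 4 * r * m = 3 * r * m + r * m := by ring
        omega
      rw [div_le_iff₀ (by positivity)]
      simp only [hS₂]
      have h6 : (32 : ℝ) ^ r * (1 / 8) ^ r = 4 ^ r := by rw [← mul_pow]; norm_num
      have h7 : (4 : ℝ) ^ 2 ≤ 4 ^ r := pow_le_pow_right₀ (by norm_num) hr
      have h9 : e ≤ (σ ^ (5 * x) - e) * ((1 / 8) ^ r / 4) := by
        have : (32 ^ r * e - e) * ((1 / 8) ^ r / 4) ≤ (σ ^ (5 * x) - e) * ((1 / 8) ^ r / 4) := by
          gcongr
        refine le_trans ?_ this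
        have : (32 ^ r * e - e) * ((1 / 8 : ℝ) ^ r / 4) = e * (4 ^ r - (1 / 8) ^ r) / 4 := by
          rw [← h6]; ring
        rw [this]
        nlinarith
      nlinarith
  · intro x y
    have hq0 : (0 : ℝ) ≤ 5 * y / m := by positivity
    have hE : 0 ≤ A * e := by positivity
    set q : ℝ := 5 * y / m with hq
    set s := max 0 (min (σ ^ x) (S₂ x)) with hs
    have hs0 : 0 ≤ s := le_max_left _ _
    rcases eq_or_lt_of_le hs0 with h0 | h0
    · have : 0 ≤ max 0 (min (σ ^ (x + y)) (S₂ (x + y))) := le_max_left _ _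
      rw [← h0]
      nlinarith
    have hs' : s = min (σ ^ x) (S₂ x) := by
      rcases max_choice 0 (min (σ ^ x) (S₂ x)) with h | h
      · rw [hs, h] at h0; exact absurd h0 (lt_irrefl _)
      · exact h
    rcases le_total 1 q with h1 | h1
    · have : 0 ≤ max 0 (min (σ ^ (x + y)) (S₂ (x + y))) := le_max_left _ _
      nlinarith
    have ha : s ≤ σ ^ x := hs' ▸ min_le_left _ _
    have hb : s ≤ S₂ x := hs' ▸ min_le_right _ _
    suffices s * (1 - q) - q * (A * e) ≤ max 0 (min (σ ^ (x + y)) (S₂ (x + y))) by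
      linarith
    refine le_trans ?_ (le_max_right _ _)
    refine le_min ?_ ?_
    · have := hrate 1 y (by norm_num)
      rw [one_mul] at this
      rw [pow_add]
      have h2 : s * (1 - q) ≤ σ ^ x * σ ^ y := by
        gcongr
        linarith
      nlinarith
    · have := hrate 5 y (by norm_num)
      simp only [hS₂] at hb ⊢
      rw [show 5 * (x + y) = 5 * x + 5 * y by ring, pow_add]
      have h2 : (s + A * e) * (1 - q) ≤ (A * σ ^ (5 * x)) * σ ^ (5 * y) := by
        gcongr
        · linarith
        · linarith
      nlinarith

/-- The bound on the probability that a ball of radius `g` is cut when `j` supernodes are close. -/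
noncomputable def cutBound (m : ℕ) (η : ℝ) (g j : ℕ) : ℝ :=
  20 * g / m * (1 - (2 ^ j - 1) * η)

lemma IsRadiusTail.step {r m : ℕ} {E η : ℝ} {S : ℕ → ℝ} (h : IsRadiusTail r m E η S)
    (hη : 0 < η) (hm : 0 < m) {g j : ℕ} (hg : g ≤ m) (hj : j + 1 ≤ r) (d : ℕ) :
    (cutBound m η g (j + 1) - cutBound m η g j) * S (d - (r + (j + 1)) * m) +
      (cutBound m η g 0 - cutBound m η g (j + 1)) * S (d - (r + j) * m) +
      (1 - cutBound m η g 0) * S (d - g) - S (d + g) ≤ 0 := by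
  have hm' : (0 : ℝ) < m := by exact_mod_cast hm
  have hS0 : ∀ k, 0 ≤ S k := fun k => by
    rw [← h.cutoff (k + 4 * r * m) (by omega)]
    exact h.antitone (by omega)
  set a := d - (r + (j + 1)) * m with ha
  set b := d - (r + j) * m with hb
  set c := d - g with hc
  set f : ℝ := 20 * g / m with hf
  have hf0 : 0 ≤ f := by positivity
  set p : ℝ := 2 ^ j with hp
  have hp1 : 1 ≤ p := one_le_pow₀ (by norm_num)
  have hpr : p * 2 ≤ 2 ^ r := by
    rw [hp, ← pow_succ]; exact pow_le_pow_right₀ (by norm_num) hj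
  have hcut0 : cutBound m η g 0 = f := by simp [cutBound, hf]
  have hcutj : cutBound m η g j = f * (1 - (p - 1) * η) := rfl
  have hcutj' : cutBound m η g (j + 1) = f * (1 - (2 * p - 1) * η) := by
    simp only [cutBound, hf, hp, pow_succ]; ring
  have hba : S b ≤ S a := h.antitone (by
    have : (r + (j + 1)) * m = (r + j) * m + m := by ring
    omega)
  have hrate : S c - S (d + g) ≤ f / 2 * (S c + E) := by
    have h1 := h.rate c (2 * g)
    have h2 : S (c + 2 * g) ≤ S (d + g) := h.antitone (by omega)
    have h3 : 5 * ((2 * g : ℕ) : ℝ) / m = f / 2 := by rw [hf]; push_cast; ring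
    rw [h3] at h1
    linarith
  rw [hcut0, hcutj, hcutj']
  suffices f * ((p - 1) * η * S a - (2 * p - 1) * η * (S a - S b) - S c) + (S c - S (d + g)) ≤ 0 by
    nlinarith
  have hjr : (r + (j + 1)) * m ≤ 2 * r * m := Nat.mul_le_mul_right _ (by omega)
  have hjm : (r + (j + 1)) * m = r * m + j * m + m := by ring
  have hjm' : (r + j) * m = r * m + j * m := by ring
  by_cases hd : (r + (j + 1)) * m ≤ d
  · have hab : S b ≤ S a / 2 := by
      have : b = a + m := by omega
      rw [this]; exact h.decay a
    have hmain : (p - 1) * η * S a - (2 * p - 1) * η * (S a - S b) ≤ - (η * S a / 2) := by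
      have : (2 * p - 1) * η * (S a / 2) ≤ (2 * p - 1) * η * (S a - S b) := by
        have : 0 ≤ (2 * p - 1) * η := mul_nonneg (by linarith) hη.le
        gcongr
        linarith
      nlinarith
    by_cases hcM : c < 4 * r * m
    · have hEa : E ≤ η * S a := by
        refine h.fast_end a ?_
        omega
      have hSc := hS0 c
      have : f * ((p - 1) * η * S a - (2 * p - 1) * η * (S a - S b) - S c) ≤
          f * (-(E / 2) - S c) :=
        mul_le_mul_of_nonneg_left (by linarith) hf0
      nlinarith
    · have h1 : S c = 0 := h.cutoff c (not_lt.1 hcM)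
      have h2 : S (d + g) = 0 := h.cutoff _ (by omega)
      rw [h1, h2]
      have : 0 ≤ η * S a / 2 := by have := hS0 a; positivity
      nlinarith
  · have ha0 : a = 0 := by omega
    have hSc : S (2 * r * m) ≤ S c := h.antitone (by omega)
    have hS := h.slow_start
    rw [ha0, h.zero] at hba ⊢
    have h1 : 0 ≤ (2 * p - 1) * η * (1 - S b) := by
      have : 0 ≤ (2 * p - 1) * η := mul_nonneg (by linarith) hη.le
      exact mul_nonneg this (by linarith)
    have h2 : (p - 1) * η * 2 ≤ 2 * 2 ^ r * η := by nlinarith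
    have : f * ((p - 1) * η * 1 - (2 * p - 1) * η * (1 - S b) - S c) ≤
        f * (-(E / 2) - S c / 2) :=
      mul_le_mul_of_nonneg_left (by linarith) hf0
    nlinarith

/-- The probability of an event, as a real number. -/
noncomputable def prob {α : Type*} (μ : PMF α) (A : Set α) : ℝ := (μ.toOuterMeasure A).toReal

section Prob

variable {α ι : Type*}

lemma toOuterMeasure_le_one (μ : PMF α) (A : Set α) : μ.toOuterMeasure A ≤ 1 := by
  rw [PMF.toOuterMeasure_apply, ← μ.tsum_coe]
  exact ENNReal.tsum_le_tsum fun a => Set.indicator_le_self _ _ a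

lemma toOuterMeasure_ne_top (μ : PMF α) (A : Set α) : μ.toOuterMeasure A ≠ ⊤ :=
  ne_top_of_le_ne_top ENNReal.one_ne_top (toOuterMeasure_le_one μ A)

lemma prob_nonneg (μ : PMF α) (A : Set α) : 0 ≤ prob μ A := ENNReal.toReal_nonneg

lemma prob_le_one (μ : PMF α) (A : Set α) : prob μ A ≤ 1 :=
  ENNReal.toReal_mono ENNReal.one_ne_top (toOuterMeasure_le_one μ A)

lemma prob_mono_of_support {μ : PMF α} {A B : Set α} (h : ∀ a ∈ μ.support, a ∈ A → a ∈ B) :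
    prob μ A ≤ prob μ B :=
  ENNReal.toReal_mono (toOuterMeasure_ne_top μ B)
    (PMF.toOuterMeasure_mono μ fun a ⟨h1, h2⟩ => h a h2 h1)

lemma prob_mono (μ : PMF α) {A B : Set α} (h : A ⊆ B) : prob μ A ≤ prob μ B :=
  prob_mono_of_support fun _ _ ha => h ha

lemma prob_eq_zero_of_support {μ : PMF α} {A : Set α} (h : ∀ a ∈ μ.support, a ∉ A) :
    prob μ A = 0 := by
  have := prob_mono_of_support (μ := μ) (A := A) (B := ∅) fun a ha ha' => h a ha ha'
  rw [prob, prob, measure_empty, ENNReal.toReal_zero] at this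
  exact le_antisymm this (prob_nonneg μ A)

lemma prob_map {β : Type*} (f : α → β) (μ : PMF α) (A : Set β) :
    prob (μ.map f) A = prob μ (f ⁻¹' A) := by
  rw [prob, PMF.toOuterMeasure_map_apply, prob]

lemma prob_bind [Fintype ι] (p : PMF ι) (q : ι → PMF α) (A : Set α) :
    prob (p.bind q) A = ∑ i, (p i).toReal * prob (q i) A := by
  rw [prob, PMF.toOuterMeasure_bind_apply, tsum_fintype, ENNReal.toReal_sum]
  · simp_rw [ENNReal.toReal_mul, prob]
  · exact fun i _ => ENNReal.mul_ne_top (p.apply_ne_top i) (toOuterMeasure_ne_top _ _)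

lemma prob_add_prob_compl (μ : PMF α) (A : Set α) : prob μ A + prob μ Aᶜ = 1 := by
  rw [prob, prob, ← ENNReal.toReal_add (toOuterMeasure_ne_top _ _) (toOuterMeasure_ne_top _ _),
    PMF.toOuterMeasure_apply, PMF.toOuterMeasure_apply, ← ENNReal.tsum_add, ← ENNReal.toReal_one,
    ← μ.tsum_coe]
  congr 2
  ext a
  exact congrFun (Set.indicator_self_add_compl A μ) a

lemma prob_eq_sum [Fintype α] (μ : PMF α) (A : Set α) [DecidablePred (· ∈ A)] :
    prob μ A = ∑ a, (μ a).toReal * if a ∈ A then 1 else 0 := by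
  rw [prob, PMF.toOuterMeasure_apply_fintype, ENNReal.toReal_sum]
  · refine Finset.sum_congr rfl fun a _ => ?_
    by_cases h : a ∈ A <;> simp [h]
  · intro a _
    by_cases h : a ∈ A <;> simp [h, μ.apply_ne_top]

lemma prob_biUnion_le (μ : PMF α) (s : Finset ι) (A : ι → Set α) :
    prob μ (⋃ i ∈ s, A i) ≤ ∑ i ∈ s, prob μ (A i) := by
  simp only [prob]
  rw [← ENNReal.toReal_sum fun i _ => toOuterMeasure_ne_top _ _]
  exact ENNReal.toReal_mono (ENNReal.sum_ne_top.2 fun i _ => toOuterMeasure_ne_top _ _)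
    (measure_biUnion_finset_le s A)

/-- A law on `Fin M` with prescribed tail function. -/
lemma exists_pmf_of_tail {M : ℕ} {S : ℕ → ℝ} (hS : Antitone S) (h0 : S 0 = 1) (hM : S M = 0) :
    ∃ p : PMF (Fin M), ∀ k, (p k).toReal = S k - S (k + 1) := by
  have hnn : ∀ k, 0 ≤ S k - S (k + 1) := fun k => sub_nonneg.2 (hS (Nat.le_succ k))
  refine ⟨PMF.ofFintype (fun k => ENNReal.ofReal (S k - S (k + 1))) ?_, fun k => ?_⟩
  · rw [← ENNReal.ofReal_sum_of_nonneg fun (k : Fin M) _ => hnn k,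
      Fin.sum_univ_eq_sum_range (fun k => S k - S (k + 1)), Finset.sum_range_sub', h0, hM]
    simp
  · rw [PMF.ofFintype_apply, ENNReal.toReal_ofReal (hnn k)]

lemma sum_tail {M : ℕ} {S : ℕ → ℝ} (hM : ∀ k, M ≤ k → S k = 0) (x : ℕ) :
    ∑ k : Fin M, (S k - S (k + 1)) * (if x ≤ (k : ℕ) then 1 else 0) = S x := by
  rw [Fin.sum_univ_eq_sum_range (fun k => (S k - S (k + 1)) * (if x ≤ k then 1 else 0))]
  have : ∀ n, ∑ k ∈ Finset.range n, (S k - S (k + 1)) * (if x ≤ k then (1 : ℝ) else 0) =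
      S x - S (max x n) := by
    intro n
    induction n with
    | zero => simp
    | succ n ih =>
      rw [Finset.sum_range_succ, ih]
      split_ifs with h
      · rw [max_eq_right h, max_eq_right (by omega)]; ring
      · rw [max_eq_left (by omega), max_eq_left (by omega)]; ring
  rw [this, hM _ (le_max_right _ _), sub_zero]

end Prob

lemma IsRadiusTail.sum_le {r m : ℕ} {E η : ℝ} {S : ℕ → ℝ} (h : IsRadiusTail r m E η S)
    (hη : 0 < η) (hm : 0 < m) {g j : ℕ} (hg : g ≤ m) (hj : j + 1 ≤ r) (d : ℕ) {P : ℕ → ℝ}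
    (h₁ : ∀ k < 4 * r * m, k < d - (r + (j + 1)) * m → P k ≤ cutBound m η g j)
    (h₂ : ∀ k < 4 * r * m, d - (r + (j + 1)) * m ≤ k → k < d - (r + j) * m → P k ≤ cutBound m η g (j + 1))
    (h₃ : ∀ k < 4 * r * m, d - (r + j) * m ≤ k → k < d - g → P k ≤ cutBound m η g 0)
    (h₄ : ∀ k < 4 * r * m, d - g ≤ k → k < d + g → P k ≤ 1) (h₅ : ∀ k < 4 * r * m, d + g ≤ k → P k ≤ 0) :
    ∑ k : Fin (4 * r * m), (S k - S (k + 1)) * P k ≤ cutBound m η g j := by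
  have hgt : g ≤ (r + j) * m := hg.trans (Nat.le_mul_of_pos_left _ (by omega))
  have htt : (r + (j + 1)) * m = (r + j) * m + m := by ring
  set f := cutBound m η g with hf
  calc ∑ k : Fin (4 * r * m), (S k - S (k + 1)) * P k
      ≤ ∑ k : Fin (4 * r * m), (f j * ((S k - S (k + 1)) * if 0 ≤ (k : ℕ) then 1 else 0) +
          (f (j + 1) - f j) *
            ((S k - S (k + 1)) * if d - (r + (j + 1)) * m ≤ (k : ℕ) then 1 else 0) +
          (f 0 - f (j + 1)) * ((S k - S (k + 1)) * if d - (r + j) * m ≤ (k : ℕ) then 1 else 0) +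
          (1 - f 0) * ((S k - S (k + 1)) * if d - g ≤ (k : ℕ) then 1 else 0) -
          (S k - S (k + 1)) * if d + g ≤ (k : ℕ) then 1 else 0) := by
        refine Finset.sum_le_sum fun k _ => ?_
        obtain ⟨k, hkM⟩ := k
        have hw : 0 ≤ S k - S (k + 1) := sub_nonneg.2 (h.antitone (Nat.le_succ k))
        simp only
        rw [if_pos (Nat.zero_le k)]
        by_cases c₁ : d - (r + (j + 1)) * m ≤ k
        swap
        · rw [if_neg c₁, if_neg (by omega), if_neg (by omega), if_neg (by omega)]
          nlinarith [h₁ k hkM (by omega)]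
        by_cases c₂ : d - (r + j) * m ≤ k
        swap
        · rw [if_pos c₁, if_neg c₂, if_neg (by omega), if_neg (by omega)]
          nlinarith [h₂ k hkM c₁ (by omega)]
        by_cases c₃ : d - g ≤ k
        swap
        · rw [if_pos c₁, if_pos c₂, if_neg c₃, if_neg (by omega)]
          nlinarith [h₃ k hkM c₂ (by omega)]
        by_cases c₄ : d + g ≤ k
        swap
        · rw [if_pos c₁, if_pos c₂, if_pos c₃, if_neg c₄]
          nlinarith [h₄ k hkM c₃ (by omega)]
        · rw [if_pos c₁, if_pos c₂, if_pos c₃, if_pos c₄]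
          nlinarith [h₅ k hkM c₄]
    _ = f j + ((f (j + 1) - f j) * S (d - (r + (j + 1)) * m) +
          (f 0 - f (j + 1)) * S (d - (r + j) * m) + (1 - f 0) * S (d - g) - S (d + g)) := by
        simp only [Finset.sum_add_distrib, Finset.sum_sub_distrib, ← Finset.mul_sum,
          sum_tail h.cutoff, h.zero]
        ring
    _ ≤ f j := by
        have := h.step hη hm hg hj d
        linarith

/-- There are `j` removed supernodes close to `z`. -/
def NearSupernodes (G : SimpleGraph V) (w : V → V → ℕ) (r m : ℕ) (U : Set V) (𝒳 : Set (Set V))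
    (z : V) (j : ℕ) : Prop :=
  ∃ F : Finset (Set V), ↑F ⊆ 𝒳 ∧ F.card = j ∧
    ∀ X ∈ F, ∃ y, Within G w U ((r + j) * m) z y ∧ ∃ v ∈ X, G.Adj y v

/-- The labellings which separate `z` from a vertex at distance at most `g`. -/
def cutEvent {β : Type*} (G : SimpleGraph V) (w : V → V → ℕ) (g : ℕ) (z : V) : Set (V → β) :=
  {a | ∃ y, Within G w Set.univ g z y ∧ a y ≠ a z}

open Classical in
/-- Random cop decomposition, started at an arbitrary state. -/
lemma IsCopState.exists_law [Fintype V] {G : SimpleGraph V} {w : V → V → ℕ}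
    (hw : ∀ u v, w u v = w v u) {r m : ℕ} (hr : ¬ HasCliqueMinor G r) (hm : 0 < m)
    {E η : ℝ} {S : ℕ → ℝ} (hη : 0 < η) (hS : IsRadiusTail r m E η S)
    {U : Set V} {𝒳 : Set (Set V)} (h : IsCopState G w U 𝒳) :
    ∃ μ : PMF (V → V),
      (∀ a ∈ μ.support, ∀ x ∈ U, a x ∈ U ∧
        HasSparseCenters G w (4 * r * m) (9 * r) {v ∈ U | a v = a x}) ∧
      ∀ z ∈ U, ∀ g ≤ m, ∀ j, NearSupernodes G w r m U 𝒳 z j →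
        (∀ y, Within G w Set.univ g z y → y ∈ U) →
        prob μ (cutEvent G w g z) ≤ cutBound m η g j := by
  induction hn : U.ncard using Nat.strong_induction_on generalizing U 𝒳 with
  | _ n ih =>
  rcases U.eq_empty_or_nonempty with rfl | ⟨x₀, hx₀⟩
  · exact ⟨PMF.pure id, by simp, by simp⟩
  have hr1 : 1 < r := by
    have := h.card_add_one_lt hw hr (F := ∅) (by simp) hx₀ (by simp)
    simpa using this
  have hN : 0 < 4 * r * m := by positivity
  obtain ⟨T, hTU, hx₀T, hT⟩ := h.exists_skeleton hw hr hx₀ hN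
  set X : ℕ → Set V := ballAround G w U T with hX
  have hXU : ∀ k, X k ⊆ U := fun k => ballAround_subset
  have hx₀X : ∀ k, x₀ ∈ X k := fun k => ⟨x₀, hx₀T, .refl _ _ hx₀⟩
  have hrec : ∀ k : Fin (4 * r * m), ∃ μ : PMF (V → V),
      (∀ a ∈ μ.support, ∀ x ∈ U \ X k, a x ∈ U \ X k ∧
        HasSparseCenters G w (4 * r * m) (9 * r) {v ∈ U \ X k | a v = a x}) ∧
      ∀ z ∈ U \ X k, ∀ g ≤ m, ∀ j, NearSupernodes G w r m (U \ X k) (insert (X k) 𝒳) z j →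
        (∀ y, Within G w Set.univ g z y → y ∈ U \ X k) →
        prob μ (cutEvent G w g z) ≤ cutBound m η g j := fun k =>
    ih _ (hn ▸ Set.ncard_lt_ncard (Set.ssubset_iff_of_subset Set.sdiff_subset |>.2
      ⟨x₀, hx₀, fun hx => hx.2 (hx₀X k)⟩)) (hT k k.2.le).1 rfl
  choose ν hν₁ hν₂ using hrec
  obtain ⟨p, hp⟩ := exists_pmf_of_tail hS.antitone hS.zero (hS.cutoff _ le_rfl)
  set L : ℕ → (V → V) → V → V := fun k a v => if v ∈ X k then x₀ else a v with hL
  refine ⟨p.bind fun k => (ν k).map (L k), ?_, ?_⟩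
  · intro a' ha'
    obtain ⟨k, -, ha'⟩ := (PMF.mem_support_bind_iff _ _ _).1 ha'
    obtain ⟨a, ha, rfl⟩ := (PMF.mem_support_map_iff _ _ _).1 ha'
    have hne : ∀ v ∈ U, v ∉ X k → a v ∈ U ∧ a v ≠ x₀ := fun v hv hvX =>
      have := (hν₁ k a ha v ⟨hv, hvX⟩).1
      ⟨this.1, fun h => this.2 (h ▸ hx₀X k)⟩
    intro x hx
    by_cases hxX : x ∈ X k
    · have hLx : L k a x = x₀ := if_pos hxX
      refine ⟨hLx ▸ hx₀, ?_⟩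
      convert (hT k k.2.le).2 using 1
      ext v
      simp only [Set.mem_ofPred_eq, hLx]
      constructor
      · rintro ⟨hv, hvx⟩
        by_contra hvX
        exact (hne v hv hvX).2 (by simpa [hL, hvX] using hvx)
      · exact fun hv => ⟨hXU _ hv, if_pos hv⟩
    · have hLx : L k a x = a x := if_neg hxX
      refine ⟨hLx ▸ (hne x hx hxX).1, ?_⟩
      convert (hν₁ k a ha x ⟨hx, hxX⟩).2 using 1
      ext v
      simp only [Set.mem_ofPred_eq, hLx]
      constructor
      · rintro ⟨hv, hvx⟩
        by_cases hvX : v ∈ X k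
        · rw [hL] at hvx
          simp only [if_pos hvX] at hvx
          exact absurd hvx.symm (hne x hx hxX).2
        · exact ⟨⟨hv, hvX⟩, by simpa [hL, hvX] using hvx⟩
      · rintro ⟨⟨hv, hvX⟩, hvx⟩
        exact ⟨hv, by simpa [hL, hvX] using hvx⟩
  · rintro z hz g hg j ⟨F, hF𝒳, hFc, hF⟩ hball
    have hj : j + 1 < r := hFc ▸ h.card_add_one_lt hw hr hF𝒳 hz fun A hA => by
      obtain ⟨y, hy, hv⟩ := hF A hA
      exact ⟨_, y, hy, hv⟩
    have hgt : g ≤ (r + j) * m := hg.trans (Nat.le_mul_of_pos_left _ (by omega))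
    have hballU : ∀ y, Within G w Set.univ g z y → Within G w U g z y := fun y hy => hy.restrict hball
    rw [prob_bind]
    simp only [hp, prob_map]
    set P : ℕ → ℝ := fun k => if hk : k < 4 * r * m then
      prob (ν ⟨k, hk⟩) (L k ⁻¹' cutEvent G w g z) else 0 with hP
    have hPk : ∀ k : Fin (4 * r * m), prob (ν k) (L k ⁻¹' cutEvent G w g z) = P k := fun k => by
      simp [hP]
    simp only [hPk]
    have hsub : ∀ k, (∀ y, Within G w U g z y → y ∉ X k) → ∀ i,
        NearSupernodes G w r m (U \ X k) (insert (X k) 𝒳) z i → k < 4 * r * m →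
        P k ≤ cutBound m η g i := by
      intro k hk i hi hkM
      simp only [hP, dif_pos hkM]
      have hout : ∀ y, Within G w Set.univ g z y → y ∈ U \ X k := fun y hy =>
        ⟨hball y hy, hk y (hballU y hy)⟩
      have hzout := hout z (.refl _ _ trivial)
      refine (prob_mono _ ?_).trans (hν₂ ⟨k, hkM⟩ z hzout g hg i hi hout)
      rintro a ⟨y, hy, hyz⟩
      refine ⟨y, hy, ?_⟩
      simpa [hL, hzout.2, (hout y hy).2] using hyz
    have hkeep : ∀ k, (∀ y, Within G w U ((r + j) * m) z y → y ∉ X k) → k < 4 * r * m →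
        P k ≤ cutBound m η g j := by
      intro k hk hkM
      refine hsub k (fun y hy => hk y (hy.mono subset_rfl hgt)) j
        ⟨F, hF𝒳.trans (Set.subset_insert _ _), hFc, fun A hA => ?_⟩ hkM
      obtain ⟨y, hy, hv⟩ := hF A hA
      exact ⟨y, hy.restrict fun v hv => ⟨hv.mem_right, hk v hv⟩, hv⟩
    have hPout : ∀ k, 4 * r * m ≤ k → P k = 0 := fun k hk => dif_neg (by omega)
    by_cases hreach : ∃ n, ∃ t ∈ T, Within G w U n z t
    swap
    · have hall : ∀ k : Fin (4 * r * m), P k ≤ cutBound m η g j := fun k =>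
        hkeep k (fun y hy ⟨t, ht, hyt⟩ => hreach ⟨_, t, ht, hy.trans hyt⟩) k.2
      calc ∑ k : Fin (4 * r * m), (S k - S (k + 1)) * P k
          ≤ ∑ k : Fin (4 * r * m), (S k - S (k + 1)) * cutBound m η g j :=
            Finset.sum_le_sum fun k _ => mul_le_mul_of_nonneg_left (hall k)
              (sub_nonneg.2 (hS.antitone (Nat.le_succ k)))
        _ = cutBound m η g j := by
            rw [← Finset.sum_mul]
            have := sum_tail hS.cutoff 0
            simp only [Nat.zero_le, if_true, mul_one, hS.zero] at this
            rw [this, one_mul]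
    set d := Nat.find hreach with hd
    obtain ⟨t, ht, hzt⟩ := Nat.find_spec hreach
    have hmin : ∀ {n k y}, Within G w U n z y → y ∈ X k → d ≤ n + k := fun hy ⟨t, ht, hyt⟩ =>
      Nat.find_min' hreach ⟨t, ht, hy.trans hyt⟩
    have htt : (r + (j + 1)) * m = (r + j) * m + m := by ring
    refine hS.sum_le hη hm hg hj.le d ?_ ?_ ?_ ?_ ?_
    · intro k hkM hk
      refine hkeep k (fun y hy hyX => ?_) hkM
      have := hmin hy hyX
      omega
    · intro k hkM hk₁ hk₂
      have hzX : z ∉ X k := fun hzX => by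
        have := hmin (.refl 0 z hz) hzX
        omega
      obtain ⟨s, y, u, hs, hzy, hyu, hu⟩ := hzt.exists_exit hzX fun v hv => ⟨t, ht, hv⟩
      refine hsub k (fun y hy hyX => ?_) (j + 1) ⟨insert (X k) F, ?_, ?_, ?_⟩ hkM
      · have := hmin hy hyX
        omega
      · rw [Finset.coe_insert]
        exact Set.insert_subset_insert hF𝒳
      · rw [Finset.card_insert_of_notMem, hFc]
        exact fun hXF => Set.disjoint_left.1 (h.disjoint_left _ (hF𝒳 hXF)) (hx₀X k) hx₀
      · intro A hA
        rcases Finset.mem_insert.1 hA with rfl | hA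
        · exact ⟨y, hzy.mono subset_rfl (by omega), u, hu, hyu⟩
        · obtain ⟨y, hy, hv⟩ := hF A hA
          have hyX : Within G w (U \ X k) ((r + j) * m) z y := hy.restrict fun v hv =>
            ⟨hv.mem_right, fun hvX => by have := hmin hv hvX; omega⟩
          exact ⟨y, hyX.mono subset_rfl (by omega), hv⟩
    · intro k hkM hk₁ hk₂
      refine hsub k (fun y hy hyX => ?_) 0 ⟨∅, by simp, rfl, by simp⟩ hkM
      have := hmin hy hyX
      omega
    · intro k hkM _ _
      simp only [hP, dif_pos hkM]
      exact prob_le_one _ _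
    · intro k hkM hk
      simp only [hP, dif_pos hkM]
      refine (prob_eq_zero_of_support ?_).le
      rintro a - ⟨y, hy, hyz⟩
      have hin : ∀ v, Within G w Set.univ g z v → v ∈ X k := fun v hv =>
        ⟨t, ht, (((hballU v hv).symm hw).trans hzt).mono subset_rfl (by omega)⟩
      simp [hL, hin y hy, hin z (.refl _ _ trivial)] at hyz

open Classical in
lemma prob_uniform_window_le [Fintype V] {W : ℕ} [NeZero W] {c c' : V} (hne : c ≠ c')
    (e e' g : ℕ) :
    prob (PMF.uniformOfFintype (V → Fin W))
      {s | e + (s c : ℕ) ≤ e' + s c' ∧ e' + (s c' : ℕ) ≤ e + s c + 2 * g} ≤ (2 * g + 1) / W := by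
  set A : Set (V → Fin W) :=
    {s | e + (s c : ℕ) ≤ e' + s c' ∧ e' + (s c' : ℕ) ≤ e + s c + 2 * g} with hA
  have hW : (0 : ℝ) < W := by exact_mod_cast Nat.pos_of_ne_zero (NeZero.ne W)
  have hcard : Fintype.card A * W ≤ (2 * g + 1) * Fintype.card (V → Fin W) := by
    have hinj : Function.Injective fun p : A × Fin W =>
        ((⟨e' + (p.1.1 c' : ℕ) - (e + p.1.1 c), by
          have := p.1.2.1; have := p.1.2.2; omega⟩ : Fin (2 * g + 1)),
          Function.update p.1.1 c' p.2) := by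
      rintro ⟨⟨s, hs⟩, i⟩ ⟨⟨t, ht⟩, j⟩ hst
      simp only [Prod.mk.injEq, Fin.mk.injEq] at hst
      obtain ⟨h1, h2⟩ := hst
      have hij : i = j := by simpa using congrFun h2 c'
      have hoff : ∀ v, v ≠ c' → s v = t v := fun v hv => by simpa [hv] using congrFun h2 v
      have hc' : s c' = t c' := by
        have := hoff c hne
        have := hs.1
        have := ht.1
        rw [hoff c hne] at *
        exact Fin.ext (by omega)
      have : s = t := funext fun v => if hv : v = c' then hv ▸ hc' else hoff v hv
      subst this hij
      rfl
    have := Fintype.card_le_of_injective _ hinj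
    simpa using this
  rw [prob, PMF.toOuterMeasure_uniformOfFintype_apply, ENNReal.toReal_div, ENNReal.toReal_natCast,
    ENNReal.toReal_natCast, div_le_div_iff₀ (by exact_mod_cast Fintype.card_pos) hW]
  exact_mod_cast hcard

open Classical in
/-- Partition of clusters with sparse centers by uniformly shifted distances to the centers. -/
lemma exists_refinement [Fintype V] {G : SimpleGraph V} {w : V → V → ℕ}
    (hw : ∀ u v, w u v = w v u) {N q : ℕ} (hN : 0 < N) {a : V → V}
    (ha : ∀ x, HasSparseCenters G w N q {v | a v = a x}) :
    ∃ μ : PMF (V → V),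
      (∀ f ∈ μ.support, ∀ x y, f x = f y → Within G w {v | f v = f x} (6 * N) x y) ∧
      ∀ z, ∀ g ≤ N, (∀ y, Within G w Set.univ g z y → a y = a z) →
        prob μ (cutEvent G w g z) ≤ q ^ 2 * ((2 * g + 1) / N) := by
  have : NeZero N := ⟨hN.ne'⟩
  set X : V → Set V := fun l => {v | a v = l} with hX
  have hK : ∀ l, ∃ K, (∃ x, a x = l) → K ⊆ X l ∧
      (∀ v ∈ X l, ∃ c ∈ K, Within G w (X l) (2 * N) v c) ∧
      ∀ z, {c ∈ K | Within G w (X l) (4 * N) z c}.ncard ≤ q := by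
    intro l
    by_cases hl : ∃ x, a x = l
    · obtain ⟨x, rfl⟩ := hl
      obtain ⟨K, hK⟩ := ha x
      exact ⟨K, fun _ => hK⟩
    · exact ⟨∅, fun h => absurd h hl⟩
  choose K hK using hK
  have hKX : ∀ x, K (a x) ⊆ X (a x) := fun x => (hK _ ⟨x, rfl⟩).1
  have hcov : ∀ v, ∃ c ∈ K (a v), Within G w (X (a v)) (2 * N) v c := fun v =>
    (hK _ ⟨v, rfl⟩).2.1 v rfl
  set n := Fintype.card V with hn
  set D : V → V → ℕ := fun v c => depth G w (X (a v)) c v with hD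
  set key : (V → Fin N) → V → V → ℕ := fun s v c =>
    (D v c + s c) * n + Fintype.equivFin V c with hkey
  have hidx : ∀ c, (Fintype.equivFin V c : ℕ) < n := fun c => (Fintype.equivFin V c).2
  have hF : ∀ s v, ∃ c, (c ∈ K (a v) ∧ ∃ k, Within G w (X (a v)) k v c) ∧
      ∀ c', (c' ∈ K (a v) ∧ ∃ k, Within G w (X (a v)) k v c') → key s v c ≤ key s v c' := by
    intro s v
    obtain ⟨c, hc, hvc⟩ := hcov v
    obtain ⟨c, hc, hmin⟩ := Set.exists_min_image
      {c | c ∈ K (a v) ∧ ∃ k, Within G w (X (a v)) k v c} (key s v) (Set.toFinite _)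
      ⟨c, hc, _, hvc⟩
    exact ⟨c, hc, hmin⟩
  choose F hF hFmin using hF
  have hkey_le : ∀ {s v c c'}, key s v c ≤ key s v c' → D v c + s c ≤ D v c' + s c' := by
    intro s v c c' h
    by_contra! hcon
    have h1 : (D v c' + s c' + 1) * n ≤ (D v c + s c) * n := Nat.mul_le_mul_right _ hcon
    have := hidx c'
    simp only [hkey] at h
    rw [add_mul, one_mul] at h1
    omega
  have hdist : ∀ {s v c}, c ∈ K (a v) → (∃ k, Within G w (X (a v)) k v c) →
      D v (F s v) + s (F s v) ≤ D v c + s c := fun hc hvc => hkey_le (hFmin _ _ _ ⟨hc, hvc⟩)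
  have hF3 : ∀ s v, D v (F s v) ≤ 3 * N := by
    intro s v
    obtain ⟨c, hc, hvc⟩ := hcov v
    have h1 := hdist (s := s) hc ⟨_, hvc⟩
    have h2 : D v c ≤ 2 * N := depth_le hvc
    have := (s c).2
    omega
  have hDF : ∀ s v, Within G w (X (a v)) (D v (F s v)) v (F s v) := fun s v => by
    obtain ⟨k, hk⟩ := (hF s v).2
    exact within_depth hk
  have haF : ∀ s v, a (F s v) = a v := fun s v => hKX v (hF s v).1
  have hstar : ∀ s v, Within G w {y | F s y = F s v} (D v (F s v)) v (F s v) := by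
    intro s v
    suffices ∀ l c k x, Within G w (X l) k x c → F s x = c → k = D x c →
        Within G w {y | F s y = c} k x c from
      this _ _ _ _ (hDF s v) rfl rfl
    intro l c k x hxc
    induction hxc with
    | refl k x _ => exact fun hx _ => .refl _ _ hx
    | @step k k' x y c hx hxy hyc hk ih =>
      intro hFx hkD
      have hxl : a x = l := hx
      subst hxl
      have hay : a y = a x := hyc.mem_left
      have hDy : D x c ≤ w x y + D y c := depth_le
        (.step hx hxy (by simp only [hD]; rw [hay]; exact within_depth hyc) le_rfl)
      have hDy' : D y c ≤ k' := depth_le (by rw [hay]; exact hyc)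
      refine .step hFx hxy (ih ?_ (by omega)) hk
      have hcand : c ∈ K (a y) ∧ ∃ k, Within G w (X (a y)) k y c := by
        rw [hay]
        exact ⟨hFx ▸ (hF s x).1, _, hyc⟩
      have h1 := hFmin s y c hcand
      set c' := F s y with hc'
      have h2 : D x c' ≤ w x y + D y c' := depth_le
        (.step hx hxy (by simp only [hD]; rw [hay]; exact hay ▸ hDF s y) le_rfl)
      have h3 : key s x c ≤ key s x c' := by
        rw [← hFx]
        refine hFmin s x c' ⟨hay ▸ (hF s y).1, _, .step hx hxy (hay ▸ hDF s y) le_rfl⟩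
      have h4 : key s x c = w x y * n + key s y c := by
        simp only [hkey, show D x c = w x y + D y c by omega]; ring
      have h5 : key s x c' ≤ w x y * n + key s y c' := by
        have : (D x c' + s c') * n ≤ (w x y + D y c' + s c') * n :=
          Nat.mul_le_mul_right _ (by omega)
        simp only [hkey]
        calc _ ≤ (w x y + D y c' + s c') * n + (Fintype.equivFin V c' : ℕ) := by omega
          _ = _ := by ring
      have h6 : key s y c' = key s y c := by omega
      have h7 : (Fintype.equivFin V c' : ℕ) = Fintype.equivFin V c := by
        have := congrArg (· % n) h6
        simpa [hkey, Nat.mul_add_mod, Nat.mod_eq_of_lt (hidx _), Nat.add_mod] using this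
      exact (Fintype.equivFin V).injective (Fin.ext h7)
  refine ⟨(PMF.uniformOfFintype (V → Fin N)).map F, ?_, ?_⟩
  · intro f hf x y hxy
    obtain ⟨s, -, rfl⟩ := (PMF.mem_support_map_iff _ _ _).1 hf
    have h1 := hstar s x
    have h2 := hstar s y
    rw [← hxy] at h2
    have h3 := hF3 s x
    have h4 := hF3 s y
    rw [← hxy] at h4
    exact (h1.trans (h2.symm hw)).mono subset_rfl (by omega)
  · intro z g hg hz
    rw [prob_map]
    set Q : Finset V := (Set.toFinite {c ∈ K (a z) | Within G w (X (a z)) (4 * N) z c}).toFinset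
      with hQ
    have hQc : Q.card ≤ q := by
      rw [hQ, ← Set.ncard_eq_toFinset_card]
      exact (hK _ ⟨z, rfl⟩).2.2 z
    have hsub : F ⁻¹' cutEvent G w g z ⊆ ⋃ p ∈ Q.offDiag,
        {s : V → Fin N | D z p.1 + (s p.1 : ℕ) ≤ D z p.2 + s p.2 ∧
          D z p.2 + (s p.2 : ℕ) ≤ D z p.1 + s p.1 + 2 * g} := by
      rintro s ⟨y, hy, hyz⟩
      have hay : a y = a z := hz y hy
      have hzy : Within G w (X (a z)) g z y := hy.restrict hz
      have hFz := hDF s z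
      have hFy := hDF s y
      have hF3z := hF3 s z
      have hF3y := hF3 s y
      have hyK := (hF s y).1
      have h1 : D z (F s y) ≤ g + D y (F s y) := depth_le (hzy.trans (hay ▸ hFy))
      have h2 : D y (F s z) ≤ g + D z (F s z) :=
        depth_le (hay.symm ▸ (hzy.symm hw).trans hFz)
      have h3 := hdist (s := s) (hay ▸ hyK) ⟨_, hzy.trans (hay ▸ hFy)⟩
      have h4 := hdist (s := s) (v := y) (c := F s z) (hay.symm ▸ (hF s z).1)
        ⟨_, hay.symm ▸ (hzy.symm hw).trans hFz⟩
      simp only [Set.mem_iUnion]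
      refine ⟨(F s z, F s y), ?_, h3, by simp only; omega⟩
      simp only [Finset.mem_offDiag, hQ, Set.Finite.mem_toFinset]
      exact ⟨⟨(hF s z).1, hFz.mono subset_rfl (by omega)⟩,
        ⟨hay ▸ hyK, (hzy.trans (hay ▸ hFy)).mono subset_rfl (by omega)⟩, fun h => hyz h.symm⟩
    calc _ ≤ _ := prob_mono _ hsub
      _ ≤ _ := prob_biUnion_le _ _ _
      _ ≤ ∑ p ∈ Q.offDiag, (2 * (g : ℝ) + 1) / N :=
        Finset.sum_le_sum fun p hp => prob_uniform_window_le (Finset.mem_offDiag.1 hp).2.2 _ _ _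
      _ = Q.offDiag.card * ((2 * (g : ℝ) + 1) / N) := by rw [Finset.sum_const, nsmul_eq_mul]
      _ ≤ q ^ 2 * ((2 * g + 1) / N) := by
        have : Q.offDiag.card ≤ q ^ 2 := by
          rw [Finset.offDiag_card, sq]
          exact (Nat.sub_le _ _).trans (Nat.mul_le_mul hQc hQc)
        have : (Q.offDiag.card : ℝ) ≤ q ^ 2 := by exact_mod_cast this
        gcongr

lemma sum_toReal_eq_one {α : Type*} [Fintype α] (μ : PMF α) : ∑ a, (μ a).toReal = 1 := by
  rw [← ENNReal.toReal_sum fun a _ => μ.apply_ne_top a, ← tsum_fintype (L := .unconditional α),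
    μ.tsum_coe, ENNReal.toReal_one]

lemma cutEvent_zero {β : Type*} {G : SimpleGraph V} {w : V → V → ℕ}
    (hpos : ∀ u v, G.Adj u v → 0 < w u v) (z : V) : cutEvent (β := β) G w 0 z = ∅ := by
  refine Set.eq_empty_of_forall_notMem ?_
  rintro a ⟨y, hy, hyz⟩
  cases hy with
  | refl => exact hyz rfl
  | step _ ha _ hk =>
    have := hpos _ _ ha
    omega

open Classical in
/-- Padded random partitions of minor-free graphs with natural edge weights. -/
lemma exists_padded_law [Fintype V] {G : SimpleGraph V} {w : V → V → ℕ}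
    (hw : ∀ u v, w u v = w v u) (hpos : ∀ u v, G.Adj u v → 0 < w u v) {r m : ℕ} (hr2 : 2 ≤ r)
    (hr : ¬ HasCliqueMinor G r) (hm : 0 < m) :
    ∃ μ : PMF (V → V),
      (∀ f ∈ μ.support, ∀ x y, f x = f y → Within G w {v | f v = f x} (24 * r * m) x y) ∧
      ∀ z, ∀ g ≤ m, prob μ (cutEvent G w g z) ≤ 71 * r * (g / m) := by
  obtain ⟨E, η, S, hη, hS⟩ := exists_isRadiusTail hr2 hm
  have hinit : IsCopState G w Set.univ ∅ := by constructor <;> simp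
  obtain ⟨μ, hμ, hcut⟩ := hinit.exists_law hw hr hm hη hS
  have hN : 0 < 4 * r * m := by positivity
  have href : ∀ a : V → V, ∃ ν : PMF (V → V), a ∈ μ.support →
      (∀ f ∈ ν.support, ∀ x y, f x = f y →
        Within G w {v | f v = f x} (6 * (4 * r * m)) x y) ∧
      ∀ z, ∀ g ≤ 4 * r * m, (∀ y, Within G w Set.univ g z y → a y = a z) →
        prob ν (cutEvent G w g z) ≤
          ((9 * r : ℕ) : ℝ) ^ 2 * ((2 * g + 1) / ((4 * r * m : ℕ) : ℝ)) := by
    intro a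
    by_cases ha : a ∈ μ.support
    · obtain ⟨ν, hν⟩ := exists_refinement hw hN (a := a) fun x => by
        simpa using (hμ a ha x trivial).2
      exact ⟨ν, fun _ => hν⟩
    · exact ⟨PMF.pure a, fun h => absurd h ha⟩
  choose ν hν using href
  refine ⟨μ.bind ν, ?_, ?_⟩
  · intro f hf x y hxy
    obtain ⟨a, ha, hf⟩ := (PMF.mem_support_bind_iff _ _ _).1 hf
    exact ((hν a ha).1 f hf x y hxy).mono subset_rfl (le_of_eq (by ring))
  · intro z g hg
    have hm' : (0 : ℝ) < m := by exact_mod_cast hm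
    have hr' : (2 : ℝ) ≤ r := by exact_mod_cast hr2
    rcases Nat.eq_zero_or_pos g with rfl | hg0
    · rw [cutEvent_zero hpos, prob, measure_empty]
      simp
    have hg1 : (1 : ℝ) ≤ g := by exact_mod_cast hg0
    have hgN : g ≤ 4 * r * m := hg.trans (Nat.le_mul_of_pos_left _ (by omega))
    set B : ℝ := ((9 * r : ℕ) : ℝ) ^ 2 * ((2 * g + 1) / ((4 * r * m : ℕ) : ℝ)) with hB
    have hB0 : 0 ≤ B := by positivity
    have hone : prob μ (cutEvent G w g z) ≤ 20 * g / m := by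
      have := hcut z trivial g hg 0 ⟨∅, by simp, rfl, by simp⟩ fun _ _ => trivial
      simpa [cutBound] using this
    calc prob (μ.bind ν) (cutEvent G w g z)
        = ∑ a, (μ a).toReal * prob (ν a) (cutEvent G w g z) := prob_bind _ _ _
      _ ≤ ∑ a, ((μ a).toReal * (if a ∈ cutEvent G w g z then 1 else 0) + (μ a).toReal * B) := by
        refine Finset.sum_le_sum fun a _ => ?_
        by_cases ha : a ∈ μ.support
        swap
        · rw [PMF.mem_support_iff, not_not] at ha
          simp [ha]
        rw [← mul_add]
        refine mul_le_mul_of_nonneg_left ?_ ENNReal.toReal_nonneg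
        split_ifs with hc
        · have := prob_le_one (ν a) (cutEvent G w g z)
          linarith
        · rw [zero_add]
          refine (hν a ha).2 z g hgN fun y hy => ?_
          by_contra hyz
          exact hc ⟨y, hy, hyz⟩
      _ = prob μ (cutEvent G w g z) + B := by
        rw [Finset.sum_add_distrib, ← prob_eq_sum, ← Finset.sum_mul, sum_toReal_eq_one, one_mul]
      _ ≤ 71 * r * (g / m) := by
        have h1 : B = 81 * r * (2 * g + 1) / (4 * m) := by
          rw [hB]; push_cast; field_simp; ring
        have h2 : B ≤ 81 * r * (3 * g) / (4 * m) := by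
          rw [h1]; gcongr; linarith
        have h3 : 81 * r * (3 * g) / (4 * m) = (243 / 4) * r * ((g : ℝ) / m) := by
          field_simp; ring
        have h4 : 20 * (g : ℝ) / m = 20 * (g / m) := by ring
        have h5 : 0 ≤ (g : ℝ) / m := by positivity
        have h6 : 2 * ((g : ℝ) / m) ≤ r * (g / m) := by gcongr
        linarith

lemma walkWeight_cons {w : V → V → ℝ} {G : SimpleGraph V} {x y z : V} (h : G.Adj x y)
    (p : G.Walk y z) : walkWeight w (.cons h p) = w x y + walkWeight w p := by
  simp [walkWeight]

/-- Edge weights rounded up to multiples of `ε`. -/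
noncomputable def roundWeight (w : V → V → ℝ) (ε : ℝ) (u v : V) : ℕ := ⌈w u v / ε⌉₊

lemma Within.dIn_le {G : SimpleGraph V} {w : V → V → ℝ} {ε : ℝ} (hε : 0 < ε) {C : Set V} {n : ℕ}
    {x y : V} (h : Within G (roundWeight w ε) C n x y) :
    dIn G w C x y ≤ ENNReal.ofReal (ε * n) := by
  obtain ⟨p, hp, hpn⟩ : ∃ p : G.Walk x y, (∀ v ∈ p.support, v ∈ C) ∧ walkWeight w p ≤ ε * n := by
    induction h with
    | refl n x h =>
      exact ⟨.nil, by simpa using h, by simp only [walkWeight]; simp; positivity⟩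
    | @step k n x y z hx ha _ hk ih =>
      obtain ⟨p, hp, hpn⟩ := ih
      refine ⟨.cons ha p, by simpa using ⟨hx, hp⟩, ?_⟩
      have h1 : w x y / ε ≤ roundWeight w ε x y := Nat.le_ceil _
      rw [div_le_iff₀' hε] at h1
      have h2 : ((roundWeight w ε x y : ℕ) : ℝ) + n ≤ k := by exact_mod_cast hk
      have h3 : ε * (roundWeight w ε x y + n) ≤ ε * k := by gcongr
      rw [walkWeight_cons]
      linarith
  exact iInf_le_of_le ⟨p, hp⟩ (ENNReal.ofReal_le_ofReal hpn)

lemma exists_within_of_walk {G : SimpleGraph V} {w : V → V → ℝ} {ε : ℝ} (hε : 0 < ε)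
    (hw : ∀ u v, G.Adj u v → ε ≤ w u v) {x y : V} (p : G.Walk x y) :
    ∃ n : ℕ, Within G (roundWeight w ε) Set.univ n x y ∧ (n : ℝ) ≤ 2 * walkWeight w p / ε := by
  induction p with
  | nil => exact ⟨0, .refl _ _ trivial, by simp [walkWeight]⟩
  | @cons x y z h p ih =>
    obtain ⟨n, hn, hnp⟩ := ih
    refine ⟨_, .step trivial h hn le_rfl, ?_⟩
    have h1 : 1 ≤ w x y / ε := (one_le_div hε).2 (hw _ _ h)
    have h2 : (roundWeight w ε x y : ℝ) < w x y / ε + 1 := Nat.ceil_lt_add_one (by linarith)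
    rw [walkWeight_cons]
    push_cast
    have h3 : 2 * (w x y + walkWeight w p) / ε =
        2 * (w x y / ε) + 2 * walkWeight w p / ε := by ring
    linarith

lemma within_of_mem_gball {G : SimpleGraph V} {w : V → V → ℝ} {ε ρ : ℝ} (hε : 0 < ε)
    (hw : ∀ u v, G.Adj u v → ε ≤ w u v) {y z : V}
    (h : y ∈ gball G w z ρ) : Within G (roundWeight w ε) Set.univ ⌊2 * ρ / ε⌋₊ z y := by
  set g := ⌊2 * ρ / ε⌋₊ with hg
  have hlt : ρ < (g + 1) * ε / 2 := by
    have := Nat.lt_floor_add_one (2 * ρ / ε)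
    rw [div_lt_iff₀ hε] at this
    linarith
  have hpos : 0 < ((g : ℝ) + 1) * ε / 2 := by positivity
  have h1 : dG G w z y < ENNReal.ofReal ((g + 1) * ε / 2) :=
    lt_of_le_of_lt h ((ENNReal.ofReal_lt_ofReal_iff hpos).2 hlt)
  obtain ⟨⟨p, _⟩, hp⟩ := iInf_lt_iff.1 h1
  have hp' := (ENNReal.ofReal_lt_ofReal_iff hpos).1 hp
  obtain ⟨n, hn, hnp⟩ := exists_within_of_walk hε hw p
  refine hn.mono subset_rfl (Nat.lt_succ_iff.1 ?_)
  have : 2 * walkWeight w p / ε < g + 1 := by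
    rw [div_lt_iff₀ hε]
    simp only at hp'
    linarith
  have : (n : ℝ) < ((g + 1 : ℕ) : ℝ) := by push_cast; linarith
  exact_mod_cast this

lemma exists_min_weight [Finite V] {G : SimpleGraph V} {w : V → V → ℝ}
    (hw : ∀ u v, G.Adj u v → 0 < w u v) : ∃ ω : ℝ, 0 < ω ∧ ∀ u v, G.Adj u v → ω ≤ w u v := by
  rcases ({p : V × V | G.Adj p.1 p.2} : Set (V × V)).eq_empty_or_nonempty with h | h
  · refine ⟨1, one_pos, fun u v huv => ?_⟩
    have : (u, v) ∈ ({p : V × V | G.Adj p.1 p.2} : Set (V × V)) := huv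
    rw [h] at this
    exact this.elim
  · obtain ⟨p, hp, hmin⟩ := Set.exists_min_image _ (fun p : V × V => w p.1 p.2) (Set.toFinite _) h
    exact ⟨w p.1 p.2, hw _ _ hp, fun u v huv => hmin (u, v) huv⟩

lemma two_rpow_neg_le {x : ℝ} (h0 : 0 ≤ x) (h1 : x ≤ 1) : (2 : ℝ) ^ (-x) ≤ 1 - x / 2 := by
  rw [Real.rpow_neg (by norm_num), ← Real.inv_rpow (by norm_num)]
  have := _root_.rpow_one_add_le_one_add_mul_self (s := -(1 / 2)) (by norm_num) h0 h1
  norm_num at this ⊢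
  linarith

/-- first assertion of Theorem 1.4 / `thm:stong-list`.
For every `r ≥ 2` there are `β ≤ O(r²)` and `δ ≥ Ω(1/r²)` such that every finite
edge-weighted `K_r`-minor-free graph admits, for every `Δ > 0`, a distribution over
partitions (encoded by cluster-labelling functions `f : V → ℕ`) whose clusters have
strong diameter at most `Δ` (diameter measured in the induced subgraph on the cluster),
and for every vertex `z` and `0 ≤ γ ≤ δ` the ball `B_G(z, γΔ)` is contained in the
cluster of `z` with probability at least `2^{-βγ}`.
(The polynomial-time samplability claim is not formalized.) -/
theorem padded_partition_minor_free_strong :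
    ∃ C c : ℝ, 0 < C ∧ 0 < c ∧
      ∀ (r : ℕ), 2 ≤ r →
      ∃ β δ : ℝ, 0 < β ∧ β ≤ C * (r : ℝ)^2 ∧ 0 < δ ∧ c / (r : ℝ)^2 ≤ δ ∧
      ∀ (V : Type) (_ : Fintype V) (G : SimpleGraph V) (w : V → V → ℝ),
        (∀ u v, G.Adj u v → 0 < w u v) → (∀ u v, w u v = w v u) →
        ¬ HasCliqueMinor G r →
        ∀ Δ : ℝ, 0 < Δ →
        ∃ μ : PMF (V → ℕ),
          (∀ f ∈ μ.support, ∀ x y : V, f x = f y →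
            dIn G w {v | f v = f x} x y ≤ ENNReal.ofReal Δ) ∧
          ∀ (z : V) (γ : ℝ), 0 ≤ γ → γ ≤ δ →
            ENNReal.ofReal ((2:ℝ) ^ (-(β * γ))) ≤
              μ.toOuterMeasure {f | gball G w z (γ * Δ) ⊆ {y | f y = f z}} := by
  refine ⟨6816, 1 / 6816, by norm_num, by norm_num, fun r hr => ?_⟩
  have hr0 : (2 : ℝ) ≤ r := by exact_mod_cast hr
  have hr2 : (0 : ℝ) < (r : ℝ) ^ 2 := by positivity
  refine ⟨6816 * r ^ 2, 1 / 6816 / r ^ 2, by positivity, le_rfl, by positivity, le_rfl, ?_⟩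
  intro V _ G w hpos hsymm hminor Δ hΔ
  obtain ⟨ω, hω, hωw⟩ := exists_min_weight hpos
  obtain ⟨m, hm⟩ := exists_nat_gt (Δ / (24 * r * ω))
  have hm0 : (0 : ℝ) < m := lt_of_le_of_lt (by positivity) hm
  have hm1 : 0 < m := by exact_mod_cast hm0
  set ε : ℝ := Δ / (24 * r * m) with hε
  have hε0 : 0 < ε := by positivity
  have hεω : ε ≤ ω := by
    rw [div_lt_iff₀ (by positivity)] at hm
    rw [hε, div_le_iff₀ (by positivity)]
    linarith
  have hεw : ∀ u v, G.Adj u v → ε ≤ w u v := fun u v huv => hεω.trans (hωw u v huv)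
  obtain ⟨μ, hμ, hcut⟩ := exists_padded_law (w := roundWeight w ε)
    (fun u v => by simp only [roundWeight, hsymm u v])
    (fun u v huv => Nat.ceil_pos.2 (div_pos (hpos u v huv) hε0)) hr hminor hm1
  set L : (V → V) → V → ℕ := fun f v => Fintype.equivFin V (f v) with hL
  have hLeq : ∀ f x y, L f x = L f y ↔ f x = f y := fun f x y => by
    simp only [hL, Fin.val_inj, EmbeddingLike.apply_eq_iff_eq]
  refine ⟨μ.map L, ?_, ?_⟩
  · intro f hf x y hxy
    obtain ⟨a, ha, rfl⟩ := (PMF.mem_support_map_iff _ _ _).1 hf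
    simp only [hLeq] at hxy ⊢
    refine (hμ a ha x y hxy).dIn_le hε0 |>.trans (ENNReal.ofReal_le_ofReal (le_of_eq ?_))
    rw [hε]; push_cast; field_simp
  · intro z γ hγ0 hγ
    have hγr : 6816 * (r : ℝ) ^ 2 * γ ≤ 1 := by
      rw [div_div, le_div_iff₀ (by positivity)] at hγ
      linarith
    refine ENNReal.ofReal_le_of_le_toReal ?_
    change _ ≤ prob _ _
    set g := ⌊2 * (γ * Δ) / ε⌋₊ with hg
    have hgle : (g : ℝ) / m ≤ 48 * r * γ := by
      rw [div_le_iff₀ hm0]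
      refine (Nat.floor_le (by positivity)).trans (le_of_eq ?_)
      rw [hε]; field_simp; ring
    have hgm : g ≤ m := by
      have : (g : ℝ) / m ≤ 1 := hgle.trans (by nlinarith)
      rw [div_le_one hm0] at this
      exact_mod_cast this
    have hfail : prob (μ.map L) {f | gball G w z (γ * Δ) ⊆ {y | f y = f z}}ᶜ ≤
        71 * r * (g / m) := by
      rw [prob_map]
      refine (prob_mono _ ?_).trans (hcut z g hgm)
      intro a ha
      obtain ⟨y, hy, hyz⟩ := Set.not_subset.1 ha
      exact ⟨y, within_of_mem_gball hε0 hεw hy, fun h => hyz ((hLeq _ _ _).2 h)⟩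
    have hadd := prob_add_prob_compl (μ.map L) {f | gball G w z (γ * Δ) ⊆ {y | f y = f z}}
    have hpow := two_rpow_neg_le (x := 6816 * (r : ℝ) ^ 2 * γ) (by positivity) hγr
    have : 71 * (r : ℝ) * (g / m) ≤ 71 * r * (48 * r * γ) := by gcongr
    linarith

end KPRpaper
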